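/- Let G be a finite simple graph with at least one vertex, with strictly positive edge weights, and let ann : E(G) → (ℤ/2)^g be any function; extend ann additively to edge sets by ann(z) = Σ_{e ∈ z} ann(e), and let B = {z ∈ Z(G) : ann(z) = 0}. Assume g ≥ 1 and g ≥ dim(Z(G)/B). For h ∈ (ℤ/2)^g let W(h) be the minimum weight of a closed walk in G (based at any vertex) whose annotation is h, taken to be ∞ if no such walk exists, and define C(h,1) = W(h) and, for k > 1, C(h,k) = min{ C(h_1, k−1) + C(h_2, 1) : h_1 + h_2 = h }. Then for every h ∈ (ℤ/2)^g, C(h,g) equals the minimum weight of an element z of the cycle space Z(G) with ann(z) = h (taken to be ∞ if no such z exists). -/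

import Mathlib

/-- The cycle space of a finite simple graph over `ℤ/2`: edge sets (indicator functions
on `Sym2 V`) supported on edges of `G` in which every vertex is incident to an even
number of edges of the set. -/
def cycleSpace {V : Type*} [Fintype V] [DecidableEq V] (G : SimpleGraph V)
    [DecidableRel G.Adj] : Submodule (ZMod 2) (Sym2 V → ZMod 2) :=
  (⨅ (e : Sym2 V) (_ : e ∉ G.edgeSet),
      LinearMap.ker (LinearMap.proj (R := ZMod 2) (φ := fun _ : Sym2 V => ZMod 2) e)) ⊓
  ⨅ (v : V),
      LinearMap.ker (∑ e ∈ G.edgeFinset.filter (fun e => v ∈ e),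
        LinearMap.proj (R := ZMod 2) (φ := fun _ : Sym2 V => ZMod 2) e)

/-- The linear map extending an annotation `ann : Sym2 V → (ℤ/2)^g` additively to
edge sets: `z ↦ ∑ e, z e • ann e`. -/
noncomputable def annMap {V : Type*} [Fintype V] [DecidableEq V] {g : ℕ}
    (ann : Sym2 V → Fin g → ZMod 2) :
    (Sym2 V → ZMod 2) →ₗ[ZMod 2] (Fin g → ZMod 2) :=
  ∑ e : Sym2 V,
    (LinearMap.proj (R := ZMod 2) (φ := fun _ : Sym2 V => ZMod 2) e).smulRight (ann e)

/-- The number of traversals modulo two of each edge in a list. -/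
def edgeParity {V : Type*} [DecidableEq V] (l : List (Sym2 V)) : Sym2 V → ZMod 2 :=
  (l.map fun e => Pi.single e 1).sum

theorem edgeParity_apply {V : Type*} [DecidableEq V] (l : List (Sym2 V)) (e : Sym2 V) :
    edgeParity l e = (l.count e : ZMod 2) := by
  induction l with
  | nil => simp [edgeParity]
  | cons a l ih =>
    have : edgeParity (a :: l) = Pi.single a 1 + edgeParity l := by simp [edgeParity]
    rw [this, Pi.add_apply, ih, List.count_cons]
    by_cases h : a = e
    · subst h; simp [add_comm]
    · simp [h, Ne.symm h]

/-- The total weight of an edge set, given as an indicator function. -/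
noncomputable def edgeWeight {V : Type*} [Fintype V] (w : Sym2 V → ℝ) (z : Sym2 V → ZMod 2) : ℝ :=
  ∑ e ∈ Finset.univ.filter (fun e => z e = 1), w e

theorem edgeWeight_nonneg {V : Type*} [Fintype V] (G : SimpleGraph V) {w : Sym2 V → ℝ}
    (hw : ∀ e ∈ G.edgeSet, 0 < w e)
    {z : Sym2 V → ZMod 2} (hz : ∀ e ∉ G.edgeSet, z e = 0) : 0 ≤ edgeWeight w z := by
  refine Finset.sum_nonneg fun e he => (hw e ?_).le
  by_contra hn
  simp [hz e hn] at he

theorem edgeWeight_add_le {V : Type*} [Fintype V] (G : SimpleGraph V) {w : Sym2 V → ℝ}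
    (hw : ∀ e ∈ G.edgeSet, 0 < w e)
    {z₁ z₂ : Sym2 V → ZMod 2} (h₁ : ∀ e ∉ G.edgeSet, z₁ e = 0) (h₂ : ∀ e ∉ G.edgeSet, z₂ e = 0) :
    edgeWeight w (z₁ + z₂) ≤ edgeWeight w z₁ + edgeWeight w z₂ := by
  simp only [edgeWeight, Finset.sum_filter]
  rw [← Finset.sum_add_distrib]
  refine Finset.sum_le_sum fun e _ => ?_
  by_cases he : e ∈ G.edgeSet
  · have := hw e he
    have key : ∀ a b : ZMod 2, a + b = 1 → a = 1 ∨ b = 1 := by decide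
    have := key (z₁ e) (z₂ e)
    simp only [Pi.add_apply]
    split_ifs <;> first | linarith | tauto
  · simp [h₁ e he, h₂ e he]

section

variable {V : Type*} [Fintype V] [DecidableEq V]

theorem mem_cycleSpace_iff (G : SimpleGraph V) [DecidableRel G.Adj] (z : Sym2 V → ZMod 2) :
    z ∈ cycleSpace G ↔ (∀ e ∉ G.edgeSet, z e = 0) ∧
      ∀ v : V, ∑ e ∈ G.edgeFinset.filter (fun e => v ∈ e), z e = 0 := by
  simp [cycleSpace, LinearMap.sum_apply]

theorem annMap_apply {g : ℕ} (ann : Sym2 V → Fin g → ZMod 2) (z : Sym2 V → ZMod 2) :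
    annMap ann z = ∑ e, z e • ann e := by
  simp [annMap, LinearMap.sum_apply]

theorem annMap_edgeParity {g : ℕ} (ann : Sym2 V → Fin g → ZMod 2) (l : List (Sym2 V)) :
    annMap ann (edgeParity l) = (l.map ann).sum := by
  unfold edgeParity
  rw [map_list_sum, List.map_map]
  congr 2
  ext1 e
  simp [annMap_apply, Pi.single_apply]

/-- A walk has odd degree exactly at its endpoints, when these differ. -/
theorem sum_edgeParity_walk (G : SimpleGraph V) [DecidableRel G.Adj] (x : V) {u v : V}
    (p : G.Walk u v) :
    ∑ e ∈ G.edgeFinset.filter (fun e => x ∈ e), edgeParity p.edges e =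
      (if x = u then 1 else 0) + (if x = v then 1 else 0) := by
  induction p with
  | nil => simp [edgeParity, CharTwo.add_self_eq_zero]
  | @cons a b c h p ih =>
    have hs : edgeParity (SimpleGraph.Walk.cons h p).edges =
        Pi.single s(a, b) 1 + edgeParity p.edges := by simp [edgeParity]
    have h1 : ∑ e ∈ G.edgeFinset.filter (fun e => x ∈ e),
        (Pi.single s(a, b) 1 : Sym2 V → ZMod 2) e =
          (if x = a then 1 else 0) + (if x = b then 1 else 0) := by
      have hab := h.ne
      simp only [Pi.single_apply, Finset.sum_ite_eq', Finset.mem_filter,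
        SimpleGraph.mem_edgeFinset, SimpleGraph.mem_edgeSet, Sym2.mem_iff]
      by_cases ha : x = a
      · subst ha; simp [h, hab]
      · by_cases hb : x = b
        · subst hb; simp [h, ha]
        · simp [ha, hb]
    simp only [hs, Pi.add_apply, Finset.sum_add_distrib, h1, ih]
    split_ifs <;> decide

theorem edgeParity_mem_cycleSpace (G : SimpleGraph V) [DecidableRel G.Adj] {v : V}
    (p : G.Walk v v) : edgeParity p.edges ∈ cycleSpace G := by
  refine (mem_cycleSpace_iff G _).2 ⟨fun e he => ?_, fun x => ?_⟩
  · rw [edgeParity_apply, List.count_eq_zero_of_not_mem fun h => he (p.edges_subset_edgeSet h),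
      Nat.cast_zero]
  · rw [sum_edgeParity_walk, CharTwo.add_self_eq_zero]

/-- Every nonzero element of the cycle space contains a cycle of the graph. -/
theorem exists_isCycle_of_mem_cycleSpace (G : SimpleGraph V) [DecidableRel G.Adj]
    {z : Sym2 V → ZMod 2} (hz : z ∈ cycleSpace G) (h0 : z ≠ 0) :
    ∃ (v : V) (p : G.Walk v v), p.IsCycle ∧ ∀ e ∈ p.edges, z e = 1 := by
  classical
  obtain ⟨hsupp, hdeg⟩ := (mem_cycleSpace_iff G z).1 hz
  have hz01 : ∀ e, z e = 0 ∨ z e = 1 := fun e => by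
    generalize z e = a; revert a; decide
  set H : SimpleGraph V := SimpleGraph.fromEdgeSet {e | z e = 1} with hH
  have hHG : H ≤ G := by
    intro a b hab
    rw [hH, SimpleGraph.fromEdgeSet_adj] at hab
    by_contra hn
    have h1 : z s(a, b) = 0 := hsupp _ hn
    have h2 : z s(a, b) = 1 := hab.1
    simp [h1] at h2
  by_cases hac : H.IsAcyclic
  · exfalso
    obtain ⟨e, he⟩ := Function.ne_iff.1 h0
    have he1 : z e = 1 := (hz01 e).resolve_left he
    have heG : e ∈ G.edgeSet := by
      by_contra hn; exact he (hsupp e hn)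
    induction e with
    | _ u v =>
    have huv : H.Adj u v := by
      rw [hH, SimpleGraph.fromEdgeSet_adj]
      exact ⟨he1, (show G.Adj u v from heG).ne⟩
    have hbr := SimpleGraph.isAcyclic_iff_forall_adj_isBridge.1 hac huv
    rw [SimpleGraph.isBridge_iff] at hbr
    set H' := H.deleteEdges {s(u, v)} with hH'
    set K : Finset V := Finset.univ.filter fun x => H'.Reachable u x with hK
    have hcut : ∑ x ∈ K, ∑ e ∈ G.edgeFinset.filter (fun e => x ∈ e), z e = 0 :=
      Finset.sum_eq_zero fun x _ => hdeg x
    have hswap : ∑ x ∈ K, ∑ e ∈ G.edgeFinset.filter (fun e => x ∈ e), z e =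
        ∑ e ∈ G.edgeFinset, ∑ x ∈ K, if x ∈ e then z e else 0 := by
      simp_rw [Finset.sum_filter]
      exact Finset.sum_comm
    have hedge : ∀ a b, a ≠ b → ∑ x ∈ K, (if x ∈ s(a, b) then z s(a, b) else 0) =
        (if a ∈ K then z s(a, b) else 0) + (if b ∈ K then z s(a, b) else 0) := by
      intro a b hab
      rw [← Finset.sum_ite_eq' K a fun _ => z s(a, b),
        ← Finset.sum_ite_eq' K b fun _ => z s(a, b), ← Finset.sum_add_distrib]
      refine Finset.sum_congr rfl fun x _ => ?_
      by_cases ha : x = a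
      · subst ha; simp [hab]
      · simp [ha]
    rw [hswap, Finset.sum_eq_single s(u, v), hedge u v huv.ne] at hcut
    · have hu : u ∈ K := by simp [hK]
      have hv : v ∉ K := by simpa [hK] using hbr
      simp [hu, hv, he1] at hcut
    · intro e heG' hne
      induction e with
      | _ a b =>
      have hab : G.Adj a b := by simpa using heG'
      rw [hedge a b hab.ne]
      rcases hz01 s(a, b) with h | h
      · simp [h]
      · have hadj : H'.Adj a b := by
          rw [hH', SimpleGraph.deleteEdges_adj, hH, SimpleGraph.fromEdgeSet_adj]
          exact ⟨⟨h, hab.ne⟩, hne⟩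
        have hiff : a ∈ K ↔ b ∈ K := by
          simp only [hK, Finset.mem_filter, Finset.mem_univ, true_and]
          exact ⟨fun hr => hr.trans hadj.reachable, fun hr => hr.trans hadj.symm.reachable⟩
        by_cases hb : b ∈ K
        · simp only [hiff, hb, if_true, CharTwo.add_self_eq_zero]
        · simp only [hiff, hb, if_false, add_zero]
    · intro hn
      exact absurd (by simpa using heG) hn
  · rw [SimpleGraph.IsAcyclic] at hac
    push Not at hac
    obtain ⟨v, c, hc⟩ := hac
    refine ⟨v, c.mapLe hHG, hc.mapLe hHG, fun e he => ?_⟩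
    rw [SimpleGraph.Walk.edges_mapLe_eq_edges] at he
    have := c.edges_subset_edgeSet he
    rw [hH, SimpleGraph.edgeSet_fromEdgeSet] at this
    exact this.1

theorem edgeWeight_edgeParity_le (w : Sym2 V → ℝ) (l : List (Sym2 V)) (hw : ∀ e ∈ l, 0 ≤ w e) :
    edgeWeight w (edgeParity l) ≤ (l.map w).sum := by
  calc edgeWeight w (edgeParity l) ≤ ∑ e ∈ l.toFinset, w e := by
        refine Finset.sum_le_sum_of_subset_of_nonneg (fun e he => ?_)
          fun e he _ => hw e (List.mem_toFinset.1 he)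
        rw [List.mem_toFinset]
        by_contra hn
        simp [edgeParity_apply, List.count_eq_zero_of_not_mem hn] at he
    _ ≤ ∑ e ∈ l.toFinset, l.count e • w e := by
        refine Finset.sum_le_sum fun e he => ?_
        have hmem := List.mem_toFinset.1 he
        simpa using nsmul_le_nsmul_left (hw e hmem) (Nat.succ_le_of_lt (List.count_pos_iff.2 hmem))
    _ = (l.map w).sum := (Finset.sum_list_map_count l w).symm

/-- Removing a contained set of edges from an edge set subtracts its weight. -/
theorem sum_add_edgeWeight_add_edgeParity (w : Sym2 V → ℝ) {z : Sym2 V → ZMod 2}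
    {l : List (Sym2 V)} (hl : l.Nodup) (hz : ∀ e ∈ l, z e = 1) :
    (l.map w).sum + edgeWeight w (z + edgeParity l) = edgeWeight w z := by
  rw [← List.sum_toFinset w hl, edgeWeight, edgeWeight, ← Finset.sum_union]
  · refine Finset.sum_congr ?_ fun _ _ => rfl
    ext e
    by_cases he : e ∈ l
    · simp [he, hz e he]
    · simp [he, edgeParity_apply, List.count_eq_zero_of_not_mem he]
  · rw [Finset.disjoint_left]
    intro e he
    have he' := List.mem_toFinset.1 he
    have h2 : (1 : ZMod 2) + 1 = 0 := by decide
    simp [edgeParity_apply, List.count_eq_one_of_mem hl he', hz e he', h2]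

end

/-- Over `ℤ/2`, a vector in the span of a finite set is the sum of at most `g` of its elements,
where `g` is the dimension. -/
theorem exists_subset_card_le_sum_eq {g : ℕ} (s : Finset (Fin g → ZMod 2)) {h : Fin g → ZMod 2}
    (hs : h ∈ Submodule.span (ZMod 2) (s : Set (Fin g → ZMod 2))) :
    ∃ t ⊆ s, t.card ≤ g ∧ ∑ x ∈ t, x = h := by
  obtain ⟨b, hbs, hspan, hli⟩ := exists_linearIndependent (ZMod 2) (s : Set (Fin g → ZMod 2))
  rw [← hspan, Submodule.mem_span_set] at hs
  obtain ⟨c, hc, rfl⟩ := hs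
  have hli' : LinearIndepOn (ZMod 2) id (c.support : Set (Fin g → ZMod 2)) :=
    LinearIndepOn.mono (s := b) hli hc
  refine ⟨c.support, fun x hx => Finset.mem_coe.1 (hbs (hc hx)), ?_, ?_⟩
  · have := LinearIndependent.fintype_card_le_finrank hli'
    rw [Module.finrank_fin_fun] at this
    exact (Fintype.card_coe c.support).ge.trans this
  · refine Finset.sum_congr rfl fun x hx => ?_
    have key : ∀ a : ZMod 2, a ≠ 0 → a = 1 := by decide
    simp [key _ (Finsupp.mem_support_iff.1 hx)]

section

variable {g : ℕ} {W : (Fin g → ZMod 2) → EReal} {C : (Fin g → ZMod 2) → ℕ → EReal}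

/-- The value of the recursion is at most the total cost of any admissible choice of summands. -/
theorem recursion_le_sum (hW0 : W 0 ≤ 0) (hC1 : ∀ h, C h 1 = W h)
    (hCk : ∀ h k, 1 ≤ k → C h (k + 1) =
      sInf {x : EReal | ∃ h₁ h₂ : Fin g → ZMod 2, h₁ + h₂ = h ∧ x = C h₁ k + C h₂ 1})
    {k : ℕ} (hk : 1 ≤ k) (t : Finset (Fin g → ZMod 2)) (ht : t.card ≤ k) :
    C (∑ x ∈ t, x) k ≤ ∑ x ∈ t, W x := by
  induction k, hk using Nat.le_induction generalizing t with
  | base =>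
    rcases t.eq_empty_or_nonempty with rfl | hne
    · simpa [hC1] using hW0
    · obtain ⟨a, rfl⟩ := Finset.card_eq_one.1 (le_antisymm ht hne.card_pos)
      simp [hC1]
  | succ k hk ih =>
    have hstep : ∀ h₁ h₂ : Fin g → ZMod 2, C (h₁ + h₂) (k + 1) ≤ C h₁ k + C h₂ 1 := by
      intro h₁ h₂
      rw [hCk _ k hk]
      exact sInf_le ⟨h₁, h₂, rfl, rfl⟩
    rcases t.eq_empty_or_nonempty with rfl | ⟨a, ha⟩
    · have h0 := ih ∅ (by simp)
      have := hstep 0 0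
      rw [hC1, add_zero] at this
      simp only [Finset.sum_empty] at h0 ⊢
      calc _ ≤ _ := this
        _ ≤ 0 + 0 := add_le_add h0 hW0
        _ = 0 := add_zero 0
    · rw [← Finset.sum_erase_add t _ ha, ← Finset.sum_erase_add t W ha]
      refine (hstep _ _).trans (add_le_add (ih _ ?_) (hC1 a).le)
      rw [Finset.card_erase_of_mem ha]
      omega

/-- The recursion dominates any subadditive lower bound for its initial values. -/
theorem le_recursion {D : (Fin g → ZMod 2) → EReal} (hD : ∀ h₁ h₂, D (h₁ + h₂) ≤ D h₁ + D h₂)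
    (hDW : ∀ h, D h ≤ W h) (hC1 : ∀ h, C h 1 = W h)
    (hCk : ∀ h k, 1 ≤ k → C h (k + 1) =
      sInf {x : EReal | ∃ h₁ h₂ : Fin g → ZMod 2, h₁ + h₂ = h ∧ x = C h₁ k + C h₂ 1})
    {k : ℕ} (hk : 1 ≤ k) (h : Fin g → ZMod 2) : D h ≤ C h k := by
  induction k, hk using Nat.le_induction generalizing h with
  | base => exact (hDW h).trans (hC1 h).ge
  | succ k hk ih =>
    rw [hCk h k hk]
    refine le_sInf ?_
    rintro _ ⟨h₁, h₂, rfl, rfl⟩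
    exact (hD h₁ h₂).trans (add_le_add (ih h₁) ((hDW h₂).trans (hC1 h₂).ge))

end

section

variable {V : Type*} [Fintype V] [DecidableEq V] (G : SimpleGraph V) [DecidableRel G.Adj]
  {w : Sym2 V → ℝ} {g : ℕ} (ann : Sym2 V → Fin g → ZMod 2)

/-- The least weight of an element of the cycle space with annotation `h`. -/
noncomputable def minCycleWeight (w : Sym2 V → ℝ) (h : Fin g → ZMod 2) : EReal :=
  sInf {x : EReal | ∃ z ∈ cycleSpace G, annMap ann z = h ∧ x = (edgeWeight w z : EReal)}

theorem minCycleWeight_le (w : Sym2 V → ℝ) {z : Sym2 V → ZMod 2} (hz : z ∈ cycleSpace G)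
    {h : Fin g → ZMod 2} (hzh : annMap ann z = h) :
    minCycleWeight G ann w h ≤ (edgeWeight w z : EReal) :=
  sInf_le ⟨z, hz, hzh, rfl⟩

theorem minCycleWeight_nonneg (hw : ∀ e ∈ G.edgeSet, 0 < w e) (h : Fin g → ZMod 2) :
    0 ≤ minCycleWeight G ann w h := by
  refine le_sInf ?_
  rintro _ ⟨z, hz, -, rfl⟩
  exact EReal.coe_nonneg.2 (edgeWeight_nonneg G hw ((mem_cycleSpace_iff G z).1 hz).1)

theorem minCycleWeight_eq_top_or (w : Sym2 V → ℝ) (h : Fin g → ZMod 2) :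
    minCycleWeight G ann w h = ⊤ ∨ ∃ z ∈ cycleSpace G, annMap ann z = h ∧
      minCycleWeight G ann w h = (edgeWeight w z : EReal) := by
  set S := {x : EReal | ∃ z ∈ cycleSpace G, annMap ann z = h ∧ x = (edgeWeight w z : EReal)}
    with hS
  rcases S.eq_empty_or_nonempty with he | hne
  · left
    rw [minCycleWeight, ← hS, he, sInf_empty]
  · right
    have hfin : S.Finite := by
      refine (Set.finite_range fun z : Sym2 V → ZMod 2 => (edgeWeight w z : EReal)).subset ?_
      rintro _ ⟨z, -, -, rfl⟩
      exact ⟨z, rfl⟩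
    exact hne.csInf_mem hfin

theorem minCycleWeight_add_le (hw : ∀ e ∈ G.edgeSet, 0 < w e) (h₁ h₂ : Fin g → ZMod 2) :
    minCycleWeight G ann w (h₁ + h₂) ≤ minCycleWeight G ann w h₁ + minCycleWeight G ann w h₂ := by
  have hbot : ∀ h, minCycleWeight G ann w h ≠ ⊥ := fun h =>
    (EReal.bot_lt_zero.trans_le (minCycleWeight_nonneg G ann hw h)).ne'
  rcases minCycleWeight_eq_top_or G ann w h₁ with e₁ | ⟨z₁, hz₁, rfl, e₁⟩
  · rw [e₁, EReal.top_add_of_ne_bot (hbot _)]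
    exact le_top
  rcases minCycleWeight_eq_top_or G ann w h₂ with e₂ | ⟨z₂, hz₂, rfl, e₂⟩
  · rw [e₂, EReal.add_top_of_ne_bot (hbot _)]
    exact le_top
  rw [e₁, e₂, ← EReal.coe_add]
  refine (minCycleWeight_le G ann w (add_mem hz₁ hz₂) (map_add _ _ _)).trans ?_
  exact EReal.coe_le_coe_iff.2 (edgeWeight_add_le G hw ((mem_cycleSpace_iff G z₁).1 hz₁).1
    ((mem_cycleSpace_iff G z₂).1 hz₂).1)

/-- The annotation of an element of the cycle space lies in the span of annotations of closed walks
whose total weight is no larger. -/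
theorem exists_finset_annMap_mem_span {W : (Fin g → ZMod 2) → EReal} (hW0 : ∀ h, 0 ≤ W h)
    (hW : ∀ (v : V) (p : G.Walk v v), W (p.edges.map ann).sum ≤ ((p.edges.map w).sum : ℝ))
    {z : Sym2 V → ZMod 2} (hz : z ∈ cycleSpace G) :
    ∃ s : Finset (Fin g → ZMod 2), annMap ann z ∈ Submodule.span (ZMod 2) (s : Set _) ∧
      ∑ x ∈ s, W x ≤ (edgeWeight w z : EReal) := by
  classical
  induction hn : (Finset.univ.filter fun e => z e = 1).card using Nat.strong_induction_on
    generalizing z with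
  | _ n ih =>
  by_cases h0 : z = 0
  · subst h0
    exact ⟨∅, by simp, by simp [edgeWeight]⟩
  obtain ⟨v, p, hp, hpz⟩ := exists_isCycle_of_mem_cycleSpace G hz h0
  have hweight := fun w' : Sym2 V → ℝ =>
    sum_add_edgeWeight_add_edgeParity w' hp.edges_nodup hpz
  have hlt : (Finset.univ.filter fun e => (z + edgeParity p.edges) e = 1).card < n := by
    have h1 := hweight fun _ => 1
    simp only [edgeWeight, List.map_const', List.sum_replicate, Finset.sum_const, nsmul_eq_mul,
      mul_one, hn, SimpleGraph.Walk.length_edges] at h1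
    have h3 := hp.three_le_length
    have h2 : p.length + (Finset.univ.filter fun e => (z + edgeParity p.edges) e = 1).card = n := by
      exact_mod_cast h1
    omega
  obtain ⟨s, hs, hsw⟩ := ih _ hlt (add_mem hz (edgeParity_mem_cycleSpace G p)) rfl
  refine ⟨insert (p.edges.map ann).sum s, ?_, ?_⟩
  · rw [map_add, annMap_edgeParity] at hs
    have h1 := Submodule.span_mono (R := ZMod 2)
      (Finset.coe_subset.2 (Finset.subset_insert (p.edges.map ann).sum s)) hs
    refine (Submodule.add_mem_iff_left _ (Submodule.subset_span ?_)).1 h1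
    simp
  · rw [← hweight w, EReal.coe_add]
    refine le_trans ?_ (add_le_add (hW v p) hsw)
    by_cases hmem : (p.edges.map ann).sum ∈ s
    · rw [Finset.insert_eq_of_mem hmem]
      exact le_add_of_nonneg_left (hW0 _)
    · rw [Finset.sum_insert hmem]

end

/-- dynamic program for shortest homologous cycles.  Let `G` be a finite
simple graph with at least one vertex and strictly positive edge weights, `ann` an
annotation of the edges with values in `(ℤ/2)^g`, and `B = {z ∈ Z(G) : ann z = 0}`.
Assume `g ≥ 1` and `g ≥ dim (Z(G)/B)`.  Let `W h` be the infimum weight of a closed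
walk with annotation `h`, and let `C` satisfy `C h 1 = W h` and
`C h (k+1) = inf { C h₁ k + C h₂ 1 : h₁ + h₂ = h }`.  Then `C h g` equals the infimum
weight of an element of the cycle space `Z(G)` with annotation `h`
(all infima taken in `EReal`, with `inf ∅ = ∞`). -/
theorem dynamic_program_shortest_homologous {V : Type*} [Fintype V] [DecidableEq V]
    [Nonempty V] (G : SimpleGraph V) [DecidableRel G.Adj]
    (w : Sym2 V → ℝ) (hw : ∀ e ∈ G.edgeSet, 0 < w e)
    (g : ℕ) (hg1 : 1 ≤ g) (ann : Sym2 V → Fin g → ZMod 2)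
    (B : Submodule (ZMod 2) (Sym2 V → ZMod 2))
    (hB : B = cycleSpace G ⊓ LinearMap.ker (annMap ann))
    (hg2 : Module.finrank (ZMod 2)
        (↥(cycleSpace G) ⧸ Submodule.comap (cycleSpace G).subtype B) ≤ g)
    (W : (Fin g → ZMod 2) → EReal)
    (hW : ∀ h : Fin g → ZMod 2, W h = sInf {x : EReal | ∃ (v : V) (p : G.Walk v v),
        (p.edges.map ann).sum = h ∧ x = ((p.edges.map w).sum : ℝ)})
    (C : (Fin g → ZMod 2) → ℕ → EReal)
    (hC1 : ∀ h, C h 1 = W h)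
    (hCk : ∀ h k, 1 ≤ k → C h (k + 1) =
      sInf {x : EReal | ∃ h₁ h₂ : Fin g → ZMod 2, h₁ + h₂ = h ∧ x = C h₁ k + C h₂ 1}) :
    ∀ h : Fin g → ZMod 2, C h g =
      sInf {x : EReal | ∃ z ∈ cycleSpace G, annMap ann z = h ∧
        x = ((∑ e ∈ Finset.univ.filter (fun e => z e = 1), w e : ℝ) : EReal)} := by
  have hw' : ∀ {v : V} (p : G.Walk v v), ∀ e ∈ p.edges, 0 ≤ w e := fun p e he =>
    (hw e (p.edges_subset_edgeSet he)).le
  have hWle : ∀ (v : V) (p : G.Walk v v),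
      W (p.edges.map ann).sum ≤ ((p.edges.map w).sum : ℝ) := fun v p => by
    rw [hW]
    exact sInf_le ⟨v, p, rfl, rfl⟩
  have hDW : ∀ h, minCycleWeight G ann w h ≤ W h := by
    intro h
    rw [hW]
    refine le_sInf ?_
    rintro _ ⟨v, p, rfl, rfl⟩
    refine (minCycleWeight_le G ann w (edgeParity_mem_cycleSpace G p)
      (annMap_edgeParity ann _)).trans ?_
    exact EReal.coe_le_coe_iff.2 (edgeWeight_edgeParity_le w _ (hw' p))
  have hW0 : ∀ h, 0 ≤ W h := fun h => (minCycleWeight_nonneg G ann hw h).trans (hDW h)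
  have hWzero : W 0 ≤ 0 := by
    simpa using hWle (Classical.arbitrary V) SimpleGraph.Walk.nil
  intro h
  refine le_antisymm (le_sInf ?_)
    (le_recursion (minCycleWeight_add_le G ann hw) hDW hC1 hCk hg1 h)
  rintro _ ⟨z, hz, rfl, rfl⟩
  obtain ⟨s, hs, hsw⟩ := exists_finset_annMap_mem_span G ann hW0 hWle hz
  obtain ⟨t, hts, htg, hsum⟩ := exists_subset_card_le_sum_eq s hs
  rw [← hsum]
  exact (recursion_le_sum hWzero hC1 hCk hg1 t htg).trans
    ((Finset.sum_le_sum_of_subset_of_nonneg hts fun x _ _ => hW0 x).trans hsw)
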